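/- Let L be the lattice of flats of the uniform matroid U_{3,3} (the Boolean lattice B_3 on {1,2,3}) and let 𝒢 = {{1},{2},{3},{1,2,3}}. Then 𝒢 is a building set for L, and the Feichtner–Yuzvinsky Chow ring D(L, 𝒢) ⊗ Q is isomorphic to Q[x]/(x³), hence is not a quadratic (and so not a Koszul) algebra. -/

import Mathlib

open MvPolynomial

open scoped Classical in
/-- `𝒢` is a building set for the bounded-below poset `P` (in the sense of
Feichtner–Yuzvinsky): `⊥ ∉ 𝒢`, and for every `G ≠ ⊥`, writing `S` for the set
of maximal elements of `𝒢` lying below `G`, there is an order isomorphism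
`∏_{H ∈ S} [⊥, H] ≃ [⊥, G]` sending, for each `H ∈ S`, the tuple which is `H`
in coordinate `H` and `⊥` elsewhere to `H`. -/
def IsBuildingSet (P : Type*) [PartialOrder P] [OrderBot P] (𝒢 : Set P) : Prop :=
  (⊥ : P) ∉ 𝒢 ∧ ∀ G : P, G ≠ ⊥ →
    ∃ φ : ((H : {H : P // H ∈ 𝒢 ∧ H ≤ G ∧ ∀ H' ∈ 𝒢, H' ≤ G → H ≤ H' → H = H'}) →
        Set.Icc (⊥ : P) H.1) ≃o Set.Icc (⊥ : P) G,
      ∀ H : {H : P // H ∈ 𝒢 ∧ H ≤ G ∧ ∀ H' ∈ 𝒢, H' ≤ G → H ≤ H' → H = H'},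
        φ (fun H' => if H' = H then ⟨H'.1, ⟨bot_le, le_rfl⟩⟩ else ⟨⊥, ⟨le_rfl, bot_le⟩⟩) =
          ⟨H.1, ⟨bot_le, H.2.2.1⟩⟩

/-- The augmentation map `R^n → R/I` sending a tuple to the class of the sum of
its entries; for `n = 1` this is the canonical projection. -/
noncomputable def augMap {R : Type*} [CommRing R] (n : ℕ) (I : Ideal R) :
    (Fin n → R) →ₗ[R] R ⧸ I :=
  I.mkQ.comp (∑ j : Fin n, LinearMap.proj j)

/-- `R/I` has a linear free resolution over `R`, where "linear" means that all
the matrices of the resolution have entries in the space `V` of linear forms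
(the degree-one part of `R`).  Taking `I` to be the irrelevant ideal, this says
that the residue field has a linear resolution, i.e. that `R` is Koszul. -/
def HasLinearResolution (k : Type*) {R : Type*} [Field k] [CommRing R] [Algebra k R]
    (V : Submodule k R) (I : Ideal R) : Prop :=
  ∃ (b : ℕ → ℕ) (d : (i : ℕ) → Matrix (Fin (b i)) (Fin (b (i + 1))) R),
    b 0 = 1 ∧ (∀ i r c, d i r c ∈ V) ∧
    Function.Surjective (augMap (b 0) I) ∧
    Function.Exact (d 0).mulVecLin (augMap (b 0) I) ∧
    ∀ i, Function.Exact (d (i + 1)).mulVecLin (d i).mulVecLin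
/-- The building set `𝒢 = {{1}, {2}, {3}, {1,2,3}}` in the Boolean lattice
`B₃ = Set (Fin 3)`, the lattice of flats of the uniform matroid `U₃,₃`. -/
def BG : Set (Set (Fin 3)) := {{0}, {1}, {2}, Set.univ}

/-- A finite subset of the building set `BG` is nested if every subset of it
consisting of at least two pairwise incomparable elements has join outside
`BG`. -/
def NestedIn (s : Finset {G : Set (Fin 3) // G ∈ BG}) : Prop :=
  ∀ t ⊆ s, (∀ a ∈ t, ∀ b ∈ t, a ≠ b → ¬a.1 ⊆ b.1 ∧ ¬b.1 ⊆ a.1) → 2 ≤ t.card →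
    t.sup (fun G => G.1) ∉ BG

open scoped Classical in
/-- The defining ideal of the Feichtner–Yuzvinsky Chow ring `D(B₃, 𝒢) ⊗ ℚ`:
generated by the products `∏_{G ∈ S} x_G` over non-nested subsets `S ⊆ 𝒢` and
the linear forms `∑_{G ≥ A} x_G` over the atoms `A` of the lattice. -/
noncomputable def DIdeal : Ideal (MvPolynomial {G : Set (Fin 3) // G ∈ BG} ℚ) :=
  Ideal.span
    ({p | ∃ s : Finset {G : Set (Fin 3) // G ∈ BG}, ¬NestedIn s ∧ p = ∏ G ∈ s, X G} ∪
     {p | ∃ A : Set (Fin 3), IsAtom A ∧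
        p = ∑ᶠ G : {G : Set (Fin 3) // G ∈ BG}, if A ⊆ G.1 then X G else 0})

/-- If the maximal elements of `𝒢` below each nonempty set `G` are pairwise disjoint with
union `G`, then `𝒢` is a building set of the Boolean lattice. -/
theorem isBuildingSet_of_partition {α : Type*} {𝒢 : Set (Set α)} (hbot : ∅ ∉ 𝒢)
    (hdisj : ∀ H ∈ 𝒢, ∀ K ∈ 𝒢, H ⊆ K ∨ K ⊆ H ∨ Disjoint H K)
    (hcover : ∀ G : Set α, ∀ x ∈ G,
      ∃ H ∈ 𝒢, H ⊆ G ∧ (∀ H' ∈ 𝒢, H' ⊆ G → H ⊆ H' → H = H') ∧ x ∈ H) :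
    IsBuildingSet (Set α) 𝒢 := by
  refine ⟨hbot, fun G _ => ?_⟩
  have eq_of_mem : ∀ (H K : {H : Set α // H ∈ 𝒢 ∧ H ≤ G ∧
      ∀ H' ∈ 𝒢, H' ≤ G → H ≤ H' → H = H'}) (x : α), x ∈ H.1 → x ∈ K.1 → H = K := by
    intro H K x hH hK
    rcases hdisj H.1 H.2.1 K.1 K.2.1 with h | h | h
    · exact Subtype.ext (H.2.2.2 _ K.2.1 K.2.2.1 h)
    · exact Subtype.ext (K.2.2.2 _ H.2.1 H.2.2.1 h).symm
    · exact absurd hK (Set.disjoint_left.1 h hH)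
  let e : ((H : {H : Set α // H ∈ 𝒢 ∧ H ≤ G ∧ ∀ H' ∈ 𝒢, H' ≤ G → H ≤ H' → H = H'}) →
      Set.Icc (⊥ : Set α) H.1) ≃ Set.Icc (⊥ : Set α) G :=
    { toFun := fun f => ⟨⋃ H, (f H).1, bot_le,
        Set.iUnion_subset fun H => (f H).2.2.trans H.2.2.1⟩
      invFun := fun s H => ⟨s.1 ∩ H.1, bot_le, Set.inter_subset_right⟩
      left_inv := by
        intro f
        funext H
        refine Subtype.ext (Set.ext fun x => ?_)
        simp only [Set.mem_inter_iff, Set.mem_iUnion]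
        constructor
        · rintro ⟨⟨K, hK⟩, hx⟩
          obtain rfl := eq_of_mem K H x ((f K).2.2 hK) hx
          exact hK
        · exact fun hx => ⟨⟨H, hx⟩, (f H).2.2 hx⟩
      right_inv := by
        intro s
        refine Subtype.ext (Set.ext fun x => ?_)
        simp only [Set.mem_iUnion, Set.mem_inter_iff]
        constructor
        · rintro ⟨_, hx, _⟩
          exact hx
        · intro hx
          obtain ⟨H, h₁, h₂, h₃, h₄⟩ := hcover G x (s.2.2 hx)
          exact ⟨⟨H, h₁, h₂, h₃⟩, hx, h₄⟩ }
  refine ⟨e.toOrderIso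
    (fun f g h => Set.iUnion_mono fun H => h H)
    (fun s t h H => Set.inter_subset_inter_left _ h), fun H => ?_⟩
  refine Subtype.ext (Set.ext fun x => ?_)
  refine Set.mem_iUnion.trans ?_
  constructor
  · rintro ⟨K, hK⟩
    by_cases h : K = H
    · subst h
      simpa using hK
    · simp [h] at hK
  · intro hx
    exact ⟨H, by simpa using hx⟩

theorem singleton_mem_BG (i : Fin 3) : ({i} : Set (Fin 3)) ∈ BG := by
  fin_cases i <;> simp [BG]

theorem univ_mem_BG : (Set.univ : Set (Fin 3)) ∈ BG := by
  simp [BG]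

theorem mem_BG_iff {G : Set (Fin 3)} : G ∈ BG ↔ (∃ i, G = {i}) ∨ G = Set.univ := by
  simp [BG, Fin.exists_fin_succ, or_assoc]

theorem singleton_ne_univ (i : Fin 3) : ({i} : Set (Fin 3)) ≠ Set.univ := by
  intro h
  have h' : i + 1 ∈ ({i} : Set (Fin 3)) := h ▸ Set.mem_univ _
  simp at h'

theorem isBuildingSet_BG : IsBuildingSet (Set (Fin 3)) BG := by
  refine isBuildingSet_of_partition ?_ ?_ ?_
  · rw [mem_BG_iff]
    rintro (⟨i, hi⟩ | h)
    · exact Set.singleton_ne_empty i hi.symm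
    · exact Set.empty_ne_univ h
  · intro H hH K hK
    rcases mem_BG_iff.1 hH with ⟨i, rfl⟩ | rfl
    · by_cases hi : i ∈ K
      · exact Or.inl (Set.singleton_subset_iff.2 hi)
      · exact Or.inr (Or.inr (Set.disjoint_singleton_left.2 hi))
    · exact Or.inr (Or.inl (Set.subset_univ K))
  · intro G x hx
    by_cases hG : G = Set.univ
    · exact ⟨Set.univ, univ_mem_BG, hG.ge, fun _ _ _ h => (Set.univ_subset_iff.1 h).symm,
        Set.mem_univ x⟩
    · refine ⟨{x}, singleton_mem_BG x, Set.singleton_subset_iff.2 hx, fun H hH hHG hxH => ?_,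
        Set.mem_singleton x⟩
      rcases mem_BG_iff.1 hH with ⟨i, rfl⟩ | rfl
      · rw [Set.mem_singleton_iff.1 (hxH rfl)]
      · exact absurd (Set.univ_subset_iff.1 hHG) hG

/-- The atom `{i}` as a member of `BG`. -/
def atomBG (i : Fin 3) : {G : Set (Fin 3) // G ∈ BG} := ⟨{i}, singleton_mem_BG i⟩

/-- The top element as a member of `BG`. -/
def topBG : {G : Set (Fin 3) // G ∈ BG} := ⟨Set.univ, univ_mem_BG⟩

theorem eq_atomBG_or_eq_topBG (G : {G : Set (Fin 3) // G ∈ BG}) :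
    (∃ i, G = atomBG i) ∨ G = topBG := by
  obtain ⟨G, hG⟩ := G
  rcases mem_BG_iff.1 hG with ⟨i, rfl⟩ | rfl
  · exact Or.inl ⟨i, rfl⟩
  · exact Or.inr rfl

theorem atomBG_injective : Function.Injective atomBG := fun _ _ h =>
  Set.singleton_injective (congrArg Subtype.val h)

theorem atomBG_ne_topBG (i : Fin 3) : atomBG i ≠ topBG := fun h =>
  singleton_ne_univ i (congrArg Subtype.val h)

theorem not_nestedIn_atoms : ¬NestedIn (Finset.univ.map ⟨atomBG, atomBG_injective⟩) := by
  intro h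
  refine h _ subset_rfl ?_ (by simp) ?_
  · simp only [Finset.mem_map, Finset.mem_univ, true_and, Function.Embedding.coeFn_mk]
    rintro _ ⟨i, rfl⟩ _ ⟨j, rfl⟩ hij
    have hij' : i ≠ j := fun h => hij (h ▸ rfl)
    simp [atomBG, hij', hij'.symm]
  · convert univ_mem_BG
    rw [Finset.sup_map, Finset.sup_eq_iSup]
    ext i
    simpa [atomBG] using show i = 2 ∨ i = 1 ∨ i = 0 by fin_cases i <;> simp

theorem atomBG_mem_of_not_nestedIn {s : Finset {G : Set (Fin 3) // G ∈ BG}}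
    (hs : ¬NestedIn s) (i : Fin 3) : atomBG i ∈ s := by
  simp only [NestedIn, not_forall, not_not] at hs
  obtain ⟨t, hts, hanti, hcard, hsup⟩ := hs
  obtain ⟨a, ha, b, hb, hab⟩ := Finset.one_lt_card.1 hcard
  have htop : topBG ∉ t := by
    intro h
    by_cases hat : a = topBG
    · exact (hanti b hb topBG h (hat ▸ hab.symm)).1 (Set.subset_univ _)
    · exact (hanti a ha topBG h hat).1 (Set.subset_univ _)
  have hatom : ∀ G ∈ t, ∃ j, G = atomBG j := fun G hG =>
    (eq_atomBG_or_eq_topBG G).resolve_right fun h => htop (h ▸ hG)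
  have hle : ∀ G ∈ t, G.1 ⊆ t.sup (fun G => G.1) := fun G hG =>
    Finset.le_sup (f := fun G : {G : Set (Fin 3) // G ∈ BG} => G.1) hG
  rcases mem_BG_iff.1 hsup with ⟨k, hk⟩ | hk
  · have eq_k : ∀ G ∈ t, G = atomBG k := by
      intro G hG
      obtain ⟨j, rfl⟩ := hatom G hG
      have hj : j ∈ ({k} : Set (Fin 3)) := hk ▸ hle _ hG rfl
      rw [Set.mem_singleton_iff.1 hj]
    exact absurd ((eq_k a ha).trans (eq_k b hb).symm) hab
  · have hi : i ∈ t.sup (fun G => G.1) := hk ▸ Set.mem_univ i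
    rw [Finset.sup_eq_iSup] at hi
    simp only [Set.iSup_eq_iUnion, Set.mem_iUnion] at hi
    obtain ⟨G, hG, hiG⟩ := hi
    obtain ⟨j, rfl⟩ := hatom G hG
    rw [Set.mem_singleton_iff.1 hiG]
    exact hts hG

open scoped Classical in
theorem finsum_atom_relation (i : Fin 3) :
    (∑ᶠ G : {G : Set (Fin 3) // G ∈ BG}, if {i} ⊆ G.1 then X G else 0) =
      (X (atomBG i) + X topBG : MvPolynomial {G : Set (Fin 3) // G ∈ BG} ℚ) := by
  rw [finsum_eq_sum_of_support_subset (s := {atomBG i, topBG}),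
    Finset.sum_pair (atomBG_ne_topBG i)]
  · simp [atomBG, topBG]
  · intro G hG
    rcases eq_atomBG_or_eq_topBG G with ⟨j, rfl⟩ | rfl
    · by_cases hij : i = j
      · simp [hij]
      · simp [atomBG, hij] at hG
    · simp

theorem X_atomBG_add_X_topBG_mem (i : Fin 3) : X (atomBG i) + X topBG ∈ DIdeal :=
  Ideal.subset_span (Or.inr ⟨{i}, Set.isAtom_singleton i, (finsum_atom_relation i).symm⟩)

theorem mk_X_atomBG (i : Fin 3) :
    Ideal.Quotient.mk DIdeal (X (atomBG i)) = -Ideal.Quotient.mk DIdeal (X topBG) := by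
  rw [eq_neg_iff_add_eq_zero, ← map_add]
  exact Ideal.Quotient.eq_zero_iff_mem.2 (X_atomBG_add_X_topBG_mem i)

theorem neg_pow_three_eq_zero_iff {R : Type*} [Ring R] {a : R} : (-a) ^ 3 = 0 ↔ a ^ 3 = 0 := by
  rw [Odd.neg_pow (by decide), neg_eq_zero]

theorem mk_X_topBG_pow_three : Ideal.Quotient.mk DIdeal (X topBG) ^ 3 = 0 := by
  have h : Ideal.Quotient.mk DIdeal
      (∏ G ∈ Finset.univ.map ⟨atomBG, atomBG_injective⟩, X G) = 0 :=
    Ideal.Quotient.eq_zero_iff_mem.2 (Ideal.subset_span (Or.inl ⟨_, not_nestedIn_atoms, rfl⟩))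
  simp only [Finset.prod_map, Function.Embedding.coeFn_mk, map_prod, mk_X_atomBG,
    Finset.prod_const, Finset.card_univ, Fintype.card_fin] at h
  exact neg_pow_three_eq_zero_iff.1 h

theorem mk_X_pow_eq_zero_iff {m n : ℕ} :
    Ideal.Quotient.mk (Ideal.span {(Polynomial.X : Polynomial ℚ) ^ n}) (Polynomial.X ^ m) = 0 ↔
      n ≤ m := by
  rw [Ideal.Quotient.eq_zero_iff_mem, Ideal.mem_span_singleton,
    pow_dvd_pow_iff Polynomial.X_ne_zero Polynomial.not_isUnit_X]

open scoped Classical in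
/-- The map `ℚ[x_G] → ℚ[x]/(x³)` sending the top variable to `x` and the others to `-x`. -/
noncomputable def chowEval : MvPolynomial {G : Set (Fin 3) // G ∈ BG} ℚ →ₐ[ℚ]
    Polynomial ℚ ⧸ Ideal.span {(Polynomial.X : Polynomial ℚ) ^ 3} :=
  aeval fun G => if G = topBG then Ideal.Quotient.mk _ Polynomial.X
    else -Ideal.Quotient.mk _ Polynomial.X

theorem chowEval_X_topBG : chowEval (X topBG) = Ideal.Quotient.mk _ Polynomial.X := by
  simp [chowEval]

theorem chowEval_X_atomBG (i : Fin 3) :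
    chowEval (X (atomBG i)) = -Ideal.Quotient.mk _ Polynomial.X := by
  simp [chowEval, atomBG_ne_topBG]

theorem chowEval_eq_zero {p : MvPolynomial {G : Set (Fin 3) // G ∈ BG} ℚ} (hp : p ∈ DIdeal) :
    chowEval p = 0 := by
  suffices h : DIdeal ≤ RingHom.ker chowEval from h hp
  refine Ideal.span_le.2 ?_
  rintro p (⟨s, hs, rfl⟩ | ⟨A, hA, rfl⟩)
  · have hsub : Finset.univ.map ⟨atomBG, atomBG_injective⟩ ⊆ s := by
      intro G hG
      simp only [Finset.mem_map, Finset.mem_univ, true_and, Function.Embedding.coeFn_mk] at hG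
      obtain ⟨i, rfl⟩ := hG
      exact atomBG_mem_of_not_nestedIn hs i
    have hatoms : chowEval (∏ G ∈ Finset.univ.map ⟨atomBG, atomBG_injective⟩, X G) = 0 := by
      simp only [Finset.prod_map, Function.Embedding.coeFn_mk, map_prod, chowEval_X_atomBG,
        Finset.prod_const, Finset.card_univ, Fintype.card_fin]
      refine neg_pow_three_eq_zero_iff.2 ?_
      rw [← map_pow]
      exact mk_X_pow_eq_zero_iff.2 le_rfl
    have hdvd := map_dvd chowEval (Finset.prod_dvd_prod_of_subset _ _
      (fun G => (X G : MvPolynomial {G : Set (Fin 3) // G ∈ BG} ℚ)) hsub)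
    rw [hatoms] at hdvd
    exact zero_dvd_iff.1 hdvd
  · obtain ⟨i, rfl⟩ := Set.isAtom_iff.1 hA
    rw [finsum_atom_relation, SetLike.mem_coe, RingHom.mem_ker, map_add, chowEval_X_atomBG,
      chowEval_X_topBG, neg_add_cancel]

/-- The map from the Chow ring to `ℚ[x]/(x³)` induced by `chowEval`. -/
noncomputable def chowHom : (MvPolynomial {G : Set (Fin 3) // G ∈ BG} ℚ ⧸ DIdeal) →ₐ[ℚ]
    (Polynomial ℚ ⧸ Ideal.span {(Polynomial.X : Polynomial ℚ) ^ 3}) :=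
  Ideal.Quotient.liftₐ DIdeal chowEval fun _ hp => chowEval_eq_zero hp

theorem chowHom_mk_X_topBG :
    chowHom (Ideal.Quotient.mk DIdeal (X topBG)) = Ideal.Quotient.mk _ Polynomial.X :=
  chowEval_X_topBG

/-- The map from `ℚ[x]/(x³)` to the Chow ring sending `x` to the class of the top variable. -/
noncomputable def chowInv : (Polynomial ℚ ⧸ Ideal.span {(Polynomial.X : Polynomial ℚ) ^ 3}) →ₐ[ℚ]
    (MvPolynomial {G : Set (Fin 3) // G ∈ BG} ℚ ⧸ DIdeal) :=
  Ideal.Quotient.liftₐ _ (Polynomial.aeval (Ideal.Quotient.mk DIdeal (X topBG))) (by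
    intro p hp
    obtain ⟨q, rfl⟩ := Ideal.mem_span_singleton.1 hp
    rw [map_mul, map_pow, Polynomial.aeval_X, mk_X_topBG_pow_three, zero_mul])

theorem chowInv_mk_X :
    chowInv (Ideal.Quotient.mk _ Polynomial.X) = Ideal.Quotient.mk DIdeal (X topBG) :=
  Polynomial.aeval_X _

/-- The Chow ring is `ℚ[x]/(x³)`, with `x` corresponding to the top variable. -/
noncomputable def chowEquiv : (MvPolynomial {G : Set (Fin 3) // G ∈ BG} ℚ ⧸ DIdeal) ≃ₐ[ℚ]
    (Polynomial ℚ ⧸ Ideal.span {(Polynomial.X : Polynomial ℚ) ^ 3}) :=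
  AlgEquiv.ofAlgHom chowHom chowInv
    (by
      refine Ideal.Quotient.algHom_ext _ (Polynomial.algHom_ext ?_)
      simp [chowInv_mk_X, chowHom_mk_X_topBG])
    (by
      refine Ideal.Quotient.algHom_ext _ (MvPolynomial.algHom_ext fun G => ?_)
      rcases eq_atomBG_or_eq_topBG G with ⟨i, rfl⟩ | rfl
      · simp [mk_X_atomBG, chowInv_mk_X, chowHom_mk_X_topBG]
      · simp [chowInv_mk_X, chowHom_mk_X_topBG])

theorem mk_X_topBG_sq_ne_zero : Ideal.Quotient.mk DIdeal (X topBG) ^ 2 ≠ 0 := by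
  intro h
  have h' := congrArg chowHom h
  rw [map_pow, chowHom_mk_X_topBG, map_zero, ← map_pow, mk_X_pow_eq_zero_iff] at h'
  omega

theorem map_homogeneousSubmodule_one_le :
    Submodule.map (Ideal.Quotient.mkₐ ℚ DIdeal).toLinearMap
        (homogeneousSubmodule {G : Set (Fin 3) // G ∈ BG} ℚ 1) ≤
      Submodule.span ℚ {Ideal.Quotient.mk DIdeal (X topBG)} := by
  rw [homogeneousSubmodule_one_eq_span_X, Submodule.map_span, Submodule.span_le]
  rintro _ ⟨_, ⟨G, rfl⟩, rfl⟩
  rcases eq_atomBG_or_eq_topBG G with ⟨i, rfl⟩ | rfl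
  · simp [mk_X_atomBG]
  · exact Submodule.mem_span_singleton_self _

theorem MvPolynomial.IsHomogeneous.aeval_mul {σ R A : Type*} [CommSemiring R] [CommSemiring A]
    [Algebra R A] {p : MvPolynomial σ R} {n : ℕ} (hp : p.IsHomogeneous n) (a : A) (g : σ → A) :
    MvPolynomial.aeval (fun i => a * g i) p = a ^ n * MvPolynomial.aeval g p := by
  simp only [aeval_def, eval₂_eq, Finset.mul_sum]
  refine Finset.sum_congr rfl fun d hd => ?_
  have hdeg : ∑ i ∈ d.support, d i = n := by
    by_contra h
    exact mem_support_iff.1 hd (hp.coeff_eq_zero h)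
  simp only [mul_pow, Finset.prod_mul_distrib, Finset.prod_pow_eq_pow_sum, hdeg]
  ring

/-- `k[x]/(x³)` has no presentation by quadrics. -/
theorem not_quadratic_quotient_X_pow_three {k σ : Type*} [Field k] (S : Set (MvPolynomial σ k))
    (hS : ∀ p ∈ S, p.IsHomogeneous 2)
    (e : (MvPolynomial σ k ⧸ Ideal.span S) ≃ₐ[k]
      (Polynomial k ⧸ Ideal.span {(Polynomial.X : Polynomial k) ^ 3})) : False := by
  choose f hf using fun i => Ideal.Quotient.mk_surjective (e (Ideal.Quotient.mk _ (X i)))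
  have key : ∀ p : MvPolynomial σ k,
      e (Ideal.Quotient.mk _ p) = Ideal.Quotient.mk _ (aeval f p) := by
    intro p
    have h : e.toAlgHom.comp (Ideal.Quotient.mkₐ k (Ideal.span S)) =
        (Ideal.Quotient.mkₐ k _).comp (aeval f) :=
      MvPolynomial.algHom_ext fun i => by simp [hf]
    exact DFunLike.congr_fun h p
  have mem_iff : ∀ p : MvPolynomial σ k,
      p ∈ Ideal.span S ↔ (Polynomial.X : Polynomial k) ^ 3 ∣ aeval f p := by
    intro p
    rw [← Ideal.mem_span_singleton, ← Ideal.Quotient.eq_zero_iff_mem,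
      ← Ideal.Quotient.eq_zero_iff_mem, ← key, map_eq_zero_iff e e.injective]
  -- The augmentation of the graded ring shows that the generators map into the maximal ideal.
  have hf0 : ∀ i, Polynomial.X ∣ f i := by
    intro i
    have hmem : (X i - C ((f i).coeff 0)) ^ 3 ∈ Ideal.span S := by
      rw [mem_iff, map_pow]
      refine pow_dvd_pow_of_dvd ?_ 3
      rw [Polynomial.X_dvd_iff]
      simp [Polynomial.algebraMap_eq]
    have hker : Ideal.span S ≤ RingHom.ker (aeval (0 : σ → k)) := by
      refine Ideal.span_le.2 fun p hp => ?_
      have := (hS p hp).aeval_mul (0 : k) 0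
      simpa [RingHom.mem_ker, Pi.zero_def] using this
    have h0 := hker hmem
    rw [RingHom.mem_ker, map_pow] at h0
    rw [Polynomial.X_dvd_iff]
    simpa using eq_zero_of_pow_eq_zero h0
  choose g hg using hf0
  obtain rfl : f = fun i => Polynomial.X * g i := funext hg
  -- The leading coefficients satisfy the quadrics, so they define a point of `Spec`.
  have hker : Ideal.span S ≤
      RingHom.ker (aeval fun i => Polynomial.X * Polynomial.C ((g i).coeff 0)) := by
    refine Ideal.span_le.2 fun p hp => ?_
    have h := (mem_iff p).1 (Ideal.subset_span hp)
    rw [(hS p hp).aeval_mul, pow_succ,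
      mul_dvd_mul_iff_left (pow_ne_zero 2 Polynomial.X_ne_zero), Polynomial.X_dvd_iff] at h
    have hcomp : (aeval (fun i => Polynomial.C ((g i).coeff 0)) p : Polynomial k) =
        Polynomial.C ((aeval g p : Polynomial k).coeff 0) := by
      have h' : (aeval (fun i => Polynomial.C ((g i).coeff 0)) :
            MvPolynomial σ k →ₐ[k] Polynomial k) =
          (Polynomial.CAlgHom.comp (Polynomial.aeval (0 : k))).comp (aeval g) :=
        MvPolynomial.algHom_ext fun i => by simp [Polynomial.coeff_zero_eq_aeval_zero]
      simpa [Polynomial.coeff_zero_eq_aeval_zero] using DFunLike.congr_fun h' p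
    rw [SetLike.mem_coe, RingHom.mem_ker, (hS p hp).aeval_mul, hcomp, h, map_zero, mul_zero]
  have hg0 : ∀ i, Polynomial.X ∣ g i := by
    intro i
    have hmem : (X i) ^ 3 ∈ Ideal.span S := by
      rw [mem_iff, map_pow, aeval_X]
      exact pow_dvd_pow_of_dvd (dvd_mul_right _ _) 3
    have h0 := hker hmem
    rw [RingHom.mem_ker, map_pow, aeval_X] at h0
    have h1 := (mul_eq_zero.1 (eq_zero_of_pow_eq_zero h0)).resolve_left Polynomial.X_ne_zero
    rwa [Polynomial.C_eq_zero, ← Polynomial.X_dvd_iff] at h1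
  -- Hence every element in the image is constant modulo `x²`, contradicting surjectivity.
  have hconst : ∀ p : MvPolynomial σ k, ∃ c : k,
      Polynomial.X ^ 2 ∣ aeval (fun i => Polynomial.X * g i) p - Polynomial.C c := by
    intro p
    induction p using MvPolynomial.induction_on with
    | C a => exact ⟨a, by simp [Polynomial.algebraMap_eq]⟩
    | add p q hp hq =>
      obtain ⟨c, hc⟩ := hp
      obtain ⟨d, hd⟩ := hq
      refine ⟨c + d, ?_⟩
      rw [map_add, map_add, add_sub_add_comm]
      exact dvd_add hc hd
    | mul_X p i _ =>
      refine ⟨0, ?_⟩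
      rw [map_mul, aeval_X, map_zero, sub_zero, pow_two]
      exact Dvd.dvd.mul_left (mul_dvd_mul_left _ (hg0 i)) _
  obtain ⟨a, ha⟩ := e.surjective (Ideal.Quotient.mk _ Polynomial.X)
  obtain ⟨p, rfl⟩ := Ideal.Quotient.mk_surjective a
  rw [key, Ideal.Quotient.mk_eq_mk_iff_sub_mem, Ideal.mem_span_singleton] at ha
  obtain ⟨c, hc⟩ := hconst p
  have hdvd := dvd_sub hc ((pow_dvd_pow _ (by norm_num : 2 ≤ 3)).trans ha)
  have hcoeff := Polynomial.X_pow_dvd_iff.1 hdvd 1 one_lt_two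
  simp at hcoeff

/-- If the linear forms are multiples of `y` with `y ^ 2 ≠ 0` and `y ^ 3 = 0`, then a quotient
by an ideal containing `y` has no linear resolution. -/
theorem not_hasLinearResolution_of_pow_three_eq_zero {k R : Type*} [Field k] [CommRing R]
    [Algebra k R] {V : Submodule k R} {I : Ideal R} {y : R} (hV : V ≤ Submodule.span k {y})
    (hI : y ∈ I) (h2 : y ^ 2 ≠ 0) (h3 : y ^ 3 = 0) : ¬HasLinearResolution k V I := by
  rintro ⟨b, d, hb, hd, -, hex, hexs⟩
  choose c hc using fun i r s => Submodule.mem_span_singleton.1 (hV (hd i r s))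
  have hrange : (fun _ => y) ∈ Set.range (d 0).mulVecLin := by
    refine (hex _).1 ?_
    simp only [augMap, LinearMap.comp_apply, LinearMap.sum_apply, LinearMap.proj_apply,
      Submodule.mkQ_apply]
    exact (Submodule.Quotient.mk_eq_zero I).2 (I.sum_mem fun _ _ => hI)
  -- The composite of two consecutive differentials vanishes already at the level of scalars.
  have hscalar : ∀ r s, ∑ j, c 0 r j * c 1 j s = 0 := by
    intro r s
    have hcomp := congrFun ((hexs 0).apply_apply_eq_zero (Pi.single s 1)) r
    simp only [Matrix.mulVecLin_apply, Matrix.mulVec_single_one, Matrix.mulVec, dotProduct,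
      Matrix.col_apply, ← hc, Pi.zero_apply, smul_mul_smul_comm, ← Finset.sum_smul,
      ← pow_two] at hcomp
    exact (smul_eq_zero.1 hcomp).resolve_right h2
  have hzero : ∀ r j, c 0 r j = 0 := by
    intro r j
    have hker : (d 0).mulVecLin (Pi.single j (y ^ 2)) = 0 := by
      ext i
      simp only [Matrix.mulVecLin_apply, Matrix.mulVec_single, Pi.zero_apply]
      simp [← hc, ← pow_succ', h3]
    obtain ⟨w, hw⟩ := (hexs 0 _).1 hker
    have hsum : ∑ i, c 0 r i • (d 1).mulVecLin w i = c 0 r j • y ^ 2 := by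
      rw [hw, Finset.sum_eq_single j] <;> simp +contextual
    have hvanish : ∑ i, c 0 r i • (d 1).mulVecLin w i = 0 := by
      simp only [Matrix.mulVecLin_apply, Matrix.mulVec, dotProduct, Finset.smul_sum, ← hc]
      rw [Finset.sum_comm]
      refine Finset.sum_eq_zero fun s _ => ?_
      simp only [← smul_mul_assoc, smul_smul, ← Finset.sum_mul, ← Finset.sum_smul]
      rw [hscalar, zero_smul, zero_mul]
    exact (smul_eq_zero.1 (hsum.symm.trans hvanish)).resolve_right h2
  obtain ⟨w, hw⟩ := hrange
  have hy := congrFun hw ⟨0, by omega⟩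
  simp only [Matrix.mulVecLin_apply, Matrix.mulVec, dotProduct, ← hc, hzero, zero_smul, zero_mul,
    Finset.sum_const_zero] at hy
  exact h2 (by rw [← hy, zero_pow two_ne_zero])

/-- `𝒢 = {{1},{2},{3},{1,2,3}}` is a building set for the
Boolean lattice `B₃` (the lattice of flats of `U₃,₃`), the Chow ring
`D(B₃, 𝒢) ⊗ ℚ` is isomorphic to `ℚ[x]/(x³)`, and consequently it is not a
quadratic algebra (it admits no presentation by an ideal generated by
quadrics) and not a Koszul algebra (the residue field has no linear free
resolution over it). -/
theorem chow_B3_not_koszul :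
    IsBuildingSet (Set (Fin 3)) BG ∧
    Nonempty ((MvPolynomial {G : Set (Fin 3) // G ∈ BG} ℚ ⧸ DIdeal) ≃ₐ[ℚ]
      (Polynomial ℚ ⧸ Ideal.span {(Polynomial.X : Polynomial ℚ) ^ 3})) ∧
    (¬∃ (n : ℕ) (S : Set (MvPolynomial (Fin n) ℚ)),
      (∀ p ∈ S, p.IsHomogeneous 2) ∧
      Nonempty ((MvPolynomial (Fin n) ℚ ⧸ Ideal.span S) ≃ₐ[ℚ]
        (MvPolynomial {G : Set (Fin 3) // G ∈ BG} ℚ ⧸ DIdeal))) ∧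
    ¬HasLinearResolution ℚ
      (Submodule.map (Ideal.Quotient.mkₐ ℚ DIdeal).toLinearMap
        (homogeneousSubmodule {G : Set (Fin 3) // G ∈ BG} ℚ 1))
      (Ideal.span {a | ∃ G : {G : Set (Fin 3) // G ∈ BG},
        a = Ideal.Quotient.mk DIdeal (X G)}) := by
  refine ⟨isBuildingSet_BG, ⟨chowEquiv⟩, ?_, ?_⟩
  · rintro ⟨n, S, hS, ⟨e⟩⟩
    exact not_quadratic_quotient_X_pow_three S hS (e.trans chowEquiv)
  · exact not_hasLinearResolution_of_pow_three_eq_zero map_homogeneousSubmodule_one_le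
      (Ideal.subset_span ⟨topBG, rfl⟩) mk_X_topBG_sq_ne_zero mk_X_topBG_pow_three
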